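/- Let n ≥ 2, 0 < p < ∞, a > 0 and R > 0. There exists a constant C = C(p, a) > 0, independent of R and f, such that for every continuous function f : ℝⁿ → ℂ, ‖ x̄ ↦ f(x̄, 0) ‖_{L^p(ℝ^{n−1})} ≤ C R^{1/p} ‖ M*_R f ‖_{L^p(ℝⁿ)}, where M*_R f(x) = sup_{y∈ℝⁿ} |f(x−y)|/(1+|Ry|^a) (the right-hand side may be +∞, in which case the inequality is trivial). -/

import Mathlib

open MeasureTheory
open scoped ENNReal NNReal

noncomputable section

/-- The maximal function `M*_R f(x) = sup_y |f(x-y)| / (1 + |Ry|^a)`. -/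
def peetreMax {n : ℕ} (R a : ℝ) (f : EuclideanSpace ℝ (Fin n) → ℂ)
    (x : EuclideanSpace ℝ (Fin n)) : ℝ≥0∞ :=
  ⨆ y : EuclideanSpace ℝ (Fin n), (‖f (x - y)‖₊ : ℝ≥0∞) / ENNReal.ofReal (1 + (R * ‖y‖) ^ a)

/-- The pointwise bound `|f(x̄,0)| ≤ 2 M*_R f(x̄,t)` for `0 ≤ t ≤ 1/R`. -/
lemma peetre_pointwise {m : ℕ} {a R : ℝ} (ha : 0 < a) (hR : 0 < R)
    (f : EuclideanSpace ℝ (Fin (m+1)) → ℂ) (v : Fin m → ℝ) (t : ℝ) (ht0 : 0 ≤ t)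
    (ht : t ≤ 1 / R) :
    (‖f (WithLp.toLp 2 (Fin.snoc v 0 : Fin (m+1) → ℝ))‖₊ : ℝ≥0∞) ≤
      2 * peetreMax R a f (WithLp.toLp 2 (Fin.snoc v t : Fin (m+1) → ℝ)) := by
  have h1 := le_iSup (fun y : EuclideanSpace ℝ (Fin (m+1)) =>
    (‖f (WithLp.toLp 2 (Fin.snoc v t : Fin (m+1) → ℝ) - y)‖₊ : ℝ≥0∞) /
      ENNReal.ofReal (1 + (R * ‖y‖) ^ a)) (EuclideanSpace.single (Fin.last m) t)
  have hsub : (WithLp.toLp 2 (Fin.snoc v t : Fin (m+1) → ℝ) : EuclideanSpace ℝ (Fin (m+1)))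
      - EuclideanSpace.single (Fin.last m) t
      = WithLp.toLp 2 (Fin.snoc v 0 : Fin (m+1) → ℝ) := by
    ext i
    refine Fin.lastCases ?_ (fun j => ?_) i
    · simp
    · simp [Fin.castSucc_ne_last]
  have hn : ‖EuclideanSpace.single (Fin.last m) t‖ = t := by
    simp [abs_of_nonneg ht0]
  simp only [hsub, hn] at h1
  have h2 : ENNReal.ofReal (1 + (R * t) ^ a) ≤ 2 := by
    have h3 : R * t ≤ 1 := by
      rw [le_div_iff₀ hR] at ht
      linarith
    have h4 : (R * t) ^ a ≤ 1 := Real.rpow_le_one (by positivity) h3 ha.le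
    calc ENNReal.ofReal (1 + (R * t) ^ a) ≤ ENNReal.ofReal 2 :=
          ENNReal.ofReal_le_ofReal (by linarith)
      _ = 2 := by simp
  have h5 : (‖f (WithLp.toLp 2 (Fin.snoc v 0 : Fin (m+1) → ℝ))‖₊ : ℝ≥0∞) / 2 ≤
      peetreMax R a f (WithLp.toLp 2 (Fin.snoc v t : Fin (m+1) → ℝ)) :=
    le_trans (ENNReal.div_le_div_left h2 _) h1
  rw [ENNReal.div_le_iff (by simp) (by simp)] at h5
  rwa [mul_comm]

/-- The integrated form. -/
lemma peetre_integrated {m : ℕ} {a R p : ℝ} (ha : 0 < a) (hR : 0 < R) (hp : 0 < p)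
    (f : EuclideanSpace ℝ (Fin (m+1)) → ℂ) (hf : Continuous f) :
    ENNReal.ofReal (1 / R) * ∫⁻ v : Fin m → ℝ,
      (‖f (WithLp.toLp 2 (Fin.snoc v 0 : Fin (m+1) → ℝ))‖₊ : ℝ≥0∞) ^ p ≤
    2 ^ p * ∫⁻ x : EuclideanSpace ℝ (Fin (m+1)), peetreMax R a f x ^ p := by
  set F : (Fin m → ℝ) → ℝ≥0∞ := fun v =>
    (‖f (WithLp.toLp 2 (Fin.snoc v 0 : Fin (m+1) → ℝ))‖₊ : ℝ≥0∞) ^ p with hF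
  have hFm : Measurable F := by
    have hc : Continuous fun v : Fin m → ℝ =>
        f (WithLp.toLp 2 (Fin.snoc v 0 : Fin (m+1) → ℝ)) := by
      refine hf.comp ((PiLp.continuous_toLp 2 _).comp ?_)
      refine continuous_pi fun i => ?_
      refine Fin.lastCases ?_ (fun j => ?_) i
      · simpa using continuous_const
      · simpa using continuous_apply j
    exact (hc.nnnorm.measurable.coe_nnreal_ennreal).pow_const p
  set I : ℝ → ℝ≥0∞ := (Set.Icc 0 (1 / R)).indicator 1 with hI
  have hIm : Measurable I := measurable_one.indicator measurableSet_Icc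
  have e1 : ENNReal.ofReal (1 / R) * ∫⁻ v, F v =
      ∫⁻ z : ℝ × (Fin m → ℝ), I z.1 * F z.2 := by
    rw [Measure.volume_eq_prod, lintegral_prod_mul hIm.aemeasurable hFm.aemeasurable]
    congr 1
    rw [hI, lintegral_indicator_one measurableSet_Icc, Real.volume_Icc, sub_zero]
  have mp1 := volume_preserving_piFinSuccAbove (fun _ : Fin (m+1) => ℝ) (Fin.last m)
  have mp2 := EuclideanSpace.volume_preserving_symm_measurableEquiv_toLp (Fin (m+1))
  have hG : Measurable fun z : ℝ × (Fin m → ℝ) => I z.1 * F z.2 :=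
    (hIm.comp measurable_fst).mul (hFm.comp measurable_snd)
  have mp := mp1.comp mp2
  rw [e1, ← mp.lintegral_comp hG, ← lintegral_const_mul' _ _ (by simp [hp.le])]
  refine lintegral_mono fun x => ?_
  set w : Fin (m+1) → ℝ := WithLp.ofLp x with hw
  have hx : x = WithLp.toLp 2 (Fin.snoc (Fin.init w) (w (Fin.last m)) : Fin (m+1) → ℝ) := by
    rw [Fin.snoc_init_self]
  change I (w (Fin.last m)) * F (fun j => w ((Fin.last m).succAbove j)) ≤ _
  have hinit : (fun j => w ((Fin.last m).succAbove j)) = Fin.init w := by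
    funext j
    simp [Fin.init]
  rw [hinit]
  by_cases ht : w (Fin.last m) ∈ Set.Icc 0 (1 / R)
  · rw [hI, Set.indicator_of_mem ht, Pi.one_apply, one_mul, ← ENNReal.mul_rpow_of_nonneg _ _ hp.le]
    have := peetre_pointwise ha hR f (Fin.init w) _ ht.1 ht.2
    rw [← hx] at this
    exact ENNReal.rpow_le_rpow this hp.le
  · rw [hI, Set.indicator_of_notMem ht, zero_mul]
    exact zero_le

/-- Let `n = m+1 ≥ 2`, `0 < p < ∞`, `a > 0`, `R > 0`. There is a constant
`C = C(p,a)`, independent of `R` and `f`, such that for every continuous `f : ℝⁿ → ℂ`,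
`‖f(·, 0)‖_{L^p(ℝ^{n-1})} ≤ C R^{1/p} ‖M*_R f‖_{L^p(ℝⁿ)}`. -/
theorem trace_le_maximal
    (m : ℕ) (hm : 1 ≤ m) (p : ℝ) (hp : 0 < p) (a : ℝ) (ha : 0 < a) :
    ∃ C : ℝ≥0∞, 0 < C ∧ C ≠ ∞ ∧
      ∀ (R : ℝ), 0 < R →
        ∀ f : EuclideanSpace ℝ (Fin (m+1)) → ℂ, Continuous f →
          (∫⁻ x : EuclideanSpace ℝ (Fin m),
              (‖f ((WithLp.equiv 2 (Fin (m+1) → ℝ)).symm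
                  (Fin.snoc ((WithLp.equiv 2 (Fin m → ℝ)) x) 0))‖₊ : ℝ≥0∞) ^ p) ^ (1/p) ≤
            C * ENNReal.ofReal (R ^ (1/p)) *
              (∫⁻ x : EuclideanSpace ℝ (Fin (m+1)), peetreMax R a f x ^ p) ^ (1/p) := by
  refine ⟨2, by simp, by simp, fun R hR f hf => ?_⟩
  have key := peetre_integrated ha hR hp f hf
  have e : (∫⁻ x : EuclideanSpace ℝ (Fin m),
      (‖f ((WithLp.equiv 2 (Fin (m+1) → ℝ)).symm
        (Fin.snoc ((WithLp.equiv 2 (Fin m → ℝ)) x) 0))‖₊ : ℝ≥0∞) ^ p) =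
      ∫⁻ v : Fin m → ℝ,
        (‖f (WithLp.toLp 2 (Fin.snoc v 0 : Fin (m+1) → ℝ))‖₊ : ℝ≥0∞) ^ p :=
    (EuclideanSpace.volume_preserving_symm_measurableEquiv_toLp (Fin m)).lintegral_comp_emb
      (MeasurableEquiv.measurableEmbedding _)
      (fun v => (‖f (WithLp.toLp 2 (Fin.snoc v 0 : Fin (m+1) → ℝ))‖₊ : ℝ≥0∞) ^ p)
  rw [e]
  set A := ∫⁻ v : Fin m → ℝ,
        (‖f (WithLp.toLp 2 (Fin.snoc v 0 : Fin (m+1) → ℝ))‖₊ : ℝ≥0∞) ^ p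
  set B := ∫⁻ x : EuclideanSpace ℝ (Fin (m+1)), peetreMax R a f x ^ p
  have h1 : A ≤ 2 ^ p * ENNReal.ofReal R * B := by
    calc A = ENNReal.ofReal R * (ENNReal.ofReal (1 / R) * A) := by
          rw [← mul_assoc, ← ENNReal.ofReal_mul hR.le, mul_one_div_cancel hR.ne']
          simp
      _ ≤ ENNReal.ofReal R * (2 ^ p * B) := by gcongr
      _ = 2 ^ p * ENNReal.ofReal R * B := by ring
  have hp' : 0 ≤ 1 / p := by positivity
  calc A ^ (1 / p) ≤ (2 ^ p * ENNReal.ofReal R * B) ^ (1 / p) := ENNReal.rpow_le_rpow h1 hp'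
    _ = 2 * ENNReal.ofReal (R ^ (1/p)) * B ^ (1 / p) := by
      rw [ENNReal.mul_rpow_of_nonneg _ _ hp', ENNReal.mul_rpow_of_nonneg _ _ hp',
        ← ENNReal.rpow_mul, mul_one_div_cancel hp.ne', ENNReal.rpow_one,
        ENNReal.ofReal_rpow_of_pos hR]
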